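/- Let m ≥ 1 be an integer, Y any type, and k an integer with 1 ≤ k ≤ m. The sets W°_π(Y), as π ranges over all partitions of m with exactly k parts, are pairwise disjoint and their union equals the set of multisets s ∈ Sym^m Y having exactly k distinct elements (i.e., the support of s has cardinality exactly k). This is the set-theoretic description of Sing^t(S^m Y) \ Sing^{t+1}(S^m Y) for k = m − t in Theorem 2(iv) of the paper. -/

import Mathlib

open Multiset

/-- `W π Y` is the set of multisets `a_1•{y_1} + ⋯ + a_k•{y_k}` in `Sym Y m`,
where `(a_1,…,a_k)` are the parts of the partition `π` of `m`. -/
def W {m : ℕ} (π : Nat.Partition m) (Y : Type*) : Set (Sym Y m) :=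
  {s | ∃ t : Multiset (ℕ × Y), t.map Prod.fst = π.parts ∧
        (t.map fun p => Multiset.replicate p.1 p.2).sum = s.1}


/-- `Coarsens π π′` means `π ≥ π′`, i.e. `π′` refines `π`: the parts of `π′` can be
grouped (by a surjection on the index sets of parts) so that each group sums to the
corresponding part of `π`.  Encoded via a multiset `t` of groups of parts. -/
def Coarsens {m : ℕ} (π π' : Nat.Partition m) : Prop :=
  ∃ t : Multiset (Multiset ℕ), t.map Multiset.sum = π.parts ∧ t.sum = π'.parts


/-- `Wo π Y = W π Y \ ⋃_{π′ > π} W π′ Y`, the open stratum. -/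
def Wo {m : ℕ} (π : Nat.Partition m) (Y : Type*) : Set (Sym Y m) :=
  W π Y \ ⋃ (π' : Nat.Partition m) (_ : Coarsens π' π ∧ π' ≠ π), W π' Y


/-- A multiset of nonempty groups has at most as many groups as it has elements in total. -/
theorem card_le_card_sum_of_ne_zero {α : Type*} (t : Multiset (Multiset α))
    (ht : ∀ g ∈ t, g ≠ 0) : card t ≤ card t.sum := by
  induction t using Multiset.induction_on with
  | empty => simp
  | cons g t ih =>
    have hg := Multiset.card_pos.2 (ht g (mem_cons_self g t))
    have := ih fun x hx => ht x (mem_cons_of_mem hx)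
    simp only [card_cons, sum_cons, card_add]
    omega

/-- If there are as many nonempty groups as elements in total, every group is a singleton. -/
theorem sum_eq_map_sum_of_card_le {α : Type*} [AddCommMonoid α] (t : Multiset (Multiset α))
    (ht : ∀ g ∈ t, g ≠ 0) (hc : card t.sum ≤ card t) : t.sum = t.map Multiset.sum := by
  induction t using Multiset.induction_on with
  | empty => simp
  | cons g t ih =>
    have ht' : ∀ x ∈ t, x ≠ 0 := fun x hx => ht x (mem_cons_of_mem hx)
    have hg := Multiset.card_pos.2 (ht g (mem_cons_self g t))
    have hle := card_le_card_sum_of_ne_zero t ht'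
    simp only [card_cons, sum_cons, card_add] at hc
    obtain ⟨a, rfl⟩ := Multiset.card_eq_one.1 (show card g = 1 by omega)
    rw [sum_cons, map_cons, sum_singleton, ih ht' (by omega), singleton_add]

/-- The groups witnessing a coarsening are nonempty, as the parts of a partition are positive. -/
theorem ne_zero_of_map_sum_eq_parts {m : ℕ} {π : Nat.Partition m} {t : Multiset (Multiset ℕ)}
    (ht : t.map Multiset.sum = π.parts) : ∀ g ∈ t, g ≠ 0 := by
  rintro g hg rfl
  have h0 : (0 : ℕ) ∈ π.parts := ht ▸ mem_map.2 ⟨0, hg, sum_zero⟩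
  exact (π.parts_pos h0).ne rfl

theorem Coarsens.card_le {m : ℕ} {π π' : Nat.Partition m} (h : Coarsens π π') :
    card π.parts ≤ card π'.parts := by
  obtain ⟨t, ht, ht'⟩ := h
  rw [← ht, ← ht', card_map]
  exact card_le_card_sum_of_ne_zero t (ne_zero_of_map_sum_eq_parts ht)

theorem Coarsens.antisymm {m : ℕ} {π π' : Nat.Partition m} (h : Coarsens π π')
    (h' : Coarsens π' π) : π = π' := by
  have hle := h'.card_le
  obtain ⟨t, ht, ht'⟩ := h
  rw [← ht, ← ht', card_map] at hle
  exact Nat.Partition.ext (by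
    rw [← ht, ← ht', sum_eq_map_sum_of_card_le t (ne_zero_of_map_sum_eq_parts ht) hle])

/-- Grouping the pairs of `t` by their second component loses nothing. -/
theorem sum_map_fst_filter_snd_eq {α Y : Type*} [DecidableEq Y] (t : Multiset (α × Y))
    (S : Finset Y) (hS : ∀ p ∈ t, p.2 ∈ S) :
    ∑ y ∈ S, (t.filter fun p => p.2 = y).map Prod.fst = t.map Prod.fst := by
  induction t using Multiset.induction_on with
  | empty => simp
  | cons p t ih =>
    have hp := hS p (mem_cons_self p t)
    have hsplit (y : Y) : ((p ::ₘ t).filter fun q => q.2 = y).map Prod.fst =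
        (if p.2 = y then {p.1} else 0) + (t.filter fun q => q.2 = y).map Prod.fst := by
      split_ifs with h <;> simp [h]
    simp only [hsplit, Finset.sum_add_distrib, ih fun q hq => hS q (mem_cons_of_mem hq),
      Finset.sum_ite_eq, hp, if_true, map_cons, singleton_add]

theorem count_sum_map_replicate {Y : Type*} [DecidableEq Y] (t : Multiset (ℕ × Y)) (y : Y) :
    count y (t.map fun p => replicate p.1 p.2).sum =
      ((t.filter fun p => p.2 = y).map Prod.fst).sum := by
  induction t using Multiset.induction_on with
  | empty => simp
  | cons p t ih =>
    by_cases h : p.2 = y <;> simp [ih, h, count_replicate]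

/-- If `s ∈ W π Y`, then the partition formed by the multiplicities of `s` coarsens `π`. -/
theorem coarsens_ofSym_of_mem_W {m : ℕ} {Y : Type*} [DecidableEq Y] {π : Nat.Partition m}
    {s : Sym Y m} (hs : s ∈ W π Y) : Coarsens (Nat.Partition.ofSym s) π := by
  obtain ⟨t, ht, hts⟩ := hs
  refine ⟨s.1.dedup.map fun y => (t.filter fun p => p.2 = y).map Prod.fst, ?_, ?_⟩
  · rw [map_map]
    refine map_congr rfl fun y _ => ?_
    exact (count_sum_map_replicate t y).symm.trans (congrArg (count y) hts)
  · rw [← ht]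
    refine sum_map_fst_filter_snd_eq t s.1.toFinset fun p hp => ?_
    have hpos : 0 < p.1 := π.parts_pos (ht ▸ mem_map_of_mem Prod.fst hp)
    rw [mem_toFinset, ← hts]
    exact mem_join.2 ⟨_, mem_map_of_mem _ hp, mem_replicate.2 ⟨hpos.ne', rfl⟩⟩

theorem mem_W_ofSym {m : ℕ} {Y : Type*} [DecidableEq Y] (s : Sym Y m) :
    s ∈ W (Nat.Partition.ofSym s) Y := by
  refine ⟨s.1.dedup.map fun y => (count y s.1, y), ?_, ?_⟩
  · rw [map_map]
    rfl
  · rw [map_map]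
    simpa [Finset.sum, nsmul_singleton] using Multiset.toFinset_sum_count_nsmul_eq s.1

/-- The open stratum containing `s` is the one of the partition of multiplicities of `s`. -/
theorem mem_Wo_iff_ofSym_eq {m : ℕ} {Y : Type*} [DecidableEq Y] {π : Nat.Partition m}
    {s : Sym Y m} : s ∈ Wo π Y ↔ Nat.Partition.ofSym s = π := by
  constructor
  · rintro ⟨hW, hU⟩
    by_contra hne
    exact hU (Set.mem_iUnion₂.2 ⟨_, ⟨coarsens_ofSym_of_mem_W hW, hne⟩, mem_W_ofSym s⟩)
  · rintro rfl
    refine ⟨mem_W_ofSym s, fun hU => ?_⟩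
    obtain ⟨π', ⟨hc, hne⟩, hW⟩ := Set.mem_iUnion₂.1 hU
    exact hne (hc.antisymm (coarsens_ofSym_of_mem_W hW))

/-- The open strata `W°_π(Y)`, as `π` ranges over partitions of `m` with exactly `k`
parts, are pairwise disjoint, and their union equals the set of multisets in
`Sym^m Y` with exactly `k` distinct elements.  (Set-theoretic description of
`Sing^t(S^m Y) \ Sing^{t+1}(S^m Y)` for `k = m - t`.) -/
theorem pairwise_disjoint_Wo_and_iUnion_Wo_eq (m : ℕ) (Y : Type*) [DecidableEq Y]
    (k : ℕ) (hk1 : 1 ≤ k) (hkm : k ≤ m) :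
    (∀ π₁ π₂ : Nat.Partition m, Multiset.card π₁.parts = k →
        Multiset.card π₂.parts = k → π₁ ≠ π₂ → Disjoint (Wo π₁ Y) (Wo π₂ Y)) ∧
    (⋃ (π : Nat.Partition m) (_ : Multiset.card π.parts = k), Wo π Y) =
      {s : Sym Y m | s.1.toFinset.card = k} := by
  refine ⟨fun π₁ π₂ _ _ hne => Set.disjoint_left.2 fun s h₁ h₂ =>
    hne ((mem_Wo_iff_ofSym_eq.1 h₁).symm.trans (mem_Wo_iff_ofSym_eq.1 h₂)), ?_⟩
  ext s
  have hcard : card (Nat.Partition.ofSym s).parts = s.1.toFinset.card :=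
    card_map _ _
  simpa [mem_Wo_iff_ofSym_eq] using Eq.congr_left hcard
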